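/- arXiv:1407.6848 — 2 statements merged into one kernel-verified Lean document; each statement's English description precedes it below -/
import Mathlib

section
/- Let F be a cumulative distribution function on ℝ with finite mean μ. Then there exist random variables X_i, i ∈ ℕ, each with distribution F, and a random variable Z with distribution F̃ (the residual distribution of F), all defined on one atomless probability space, such that for each n ∈ ℕ, |S_n − nμ| ≤ Z almost surely, where S_n = X₁ + ⋯ + X_n. -/
open MeasureTheory ProbabilityTheory Set Filter Topology Asymptotics

noncomputable section

/-- Generalized inverse `F⁻¹` of the CDF of the distribution `ν`:
`F⁻¹(t) = inf {x | F(x) ≥ t}` for `t ≠ 0` and `F⁻¹(0) = inf {x | F(x) > 0}`. -/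
def qf (ν : Measure ℝ) (t : ℝ) : ℝ :=
  if t = 0 then sInf {x : ℝ | 0 < (ν (Iic x)).toReal}
  else sInf {x : ℝ | t ≤ (ν (Iic x)).toReal}

/-- `H(s) = ∫₀ˢ (F⁻¹(t) − μ) dt`. -/
def Hfun (ν : Measure ℝ) (μ : ℝ) (s : ℝ) : ℝ := ∫ t in (0:ℝ)..s, (qf ν t - μ)

/-- `ν = F(μ−)`. -/
def nuM (ν : Measure ℝ) (μ : ℝ) : ℝ := (ν (Iio μ)).toReal

/-- `ν⁺ = F(μ)`. -/
def nuP (ν : Measure ℝ) (μ : ℝ) : ℝ := (ν (Iic μ)).toReal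

/-- `c = H(ν)`, the minimum value of `H`. -/
def cval (ν : Measure ℝ) (μ : ℝ) : ℝ := Hfun ν μ (nuM ν μ)

/-- `A : [c,0] → [0,ν]`, the inverse of `H` on `[0,ν)`, with `A(c) = ν⁺`. -/
def Afun (ν : Measure ℝ) (μ : ℝ) (s : ℝ) : ℝ :=
  if s = cval ν μ then nuP ν μ
  else sInf {t : ℝ | t ∈ Icc 0 (nuM ν μ) ∧ Hfun ν μ t ≤ s}

/-- `B : [c,0] → [ν⁺,1]`, the inverse of `H` on `(ν⁺,1]`, with `B(c) = ν⁺`. -/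
def Bfun (ν : Measure ℝ) (μ : ℝ) (s : ℝ) : ℝ :=
  if s = cval ν μ then nuP ν μ
  else sInf {t : ℝ | t ∈ Icc (nuP ν μ) 1 ∧ s ≤ Hfun ν μ t}

/-- The distribution function `K`, supported on `[c,0]`. -/
def Kfun (ν : Measure ℝ) (μ : ℝ) (s : ℝ) : ℝ :=
  if 0 < s then 1
  else if s < cval ν μ then 0
  else if s = cval ν μ then nuP ν μ - nuM ν μ
  else Bfun ν μ s - Afun ν μ s

/-- `u(s) = (μ − F⁻¹(A(s))) / (F⁻¹(B(s)) − F⁻¹(A(s)))` for `s ∈ (c,0)`, `u(c) = 1/2`. -/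
def ufun (ν : Measure ℝ) (μ : ℝ) (s : ℝ) : ℝ :=
  if s = cval ν μ then 1/2
  else (μ - qf ν (Afun ν μ s)) / (qf ν (Bfun ν μ s) - qf ν (Afun ν μ s))

/-- Generalized inverse of the distribution function `K`. -/
def Kinv (ν : Measure ℝ) (μ : ℝ) (t : ℝ) : ℝ := sInf {s : ℝ | t ≤ Kfun ν μ s}

/-- The map `t ↦ F⁻¹(B(Y(t))) − F⁻¹(A(Y(t)))` where `Y = K⁻¹` is the quantile
transform of `K`; applied to a uniform random variable it realizes the residual
distribution of `F`. -/
def residualRV (ν : Measure ℝ) (μ : ℝ) (t : ℝ) : ℝ :=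
  qf ν (Bfun ν μ (Kinv ν μ t)) - qf ν (Afun ν μ (Kinv ν μ t))

/-- The residual distribution `F̃` of `F`: the law of `F⁻¹(B(Y)) − F⁻¹(A(Y))`
for `Y ∼ K`. -/
def residualDist (ν : Measure ℝ) (μ : ℝ) : Measure ℝ :=
  Measure.map (residualRV ν μ) (volume.restrict (Icc (0:ℝ) 1))

end

section Quantile

variable (ν : Measure ℝ)

lemma qf_of_ne_zero {t : ℝ} (ht : t ≠ 0) :
    qf ν t = sInf {x : ℝ | t ≤ (ν (Iic x)).toReal} := by
  simp [qf, ht]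

lemma nuM_nonneg (μ : ℝ) : 0 ≤ nuM ν μ := ENNReal.toReal_nonneg

variable [IsProbabilityMeasure ν]

lemma qf_le_iff {t : ℝ} (h0 : 0 < t) (h1 : t < 1) (x : ℝ) :
    qf ν t ≤ x ↔ t ≤ (ν (Iic x)).toReal := by
  have hF : ∀ y, (ν (Iic y)).toReal = cdf ν y := fun y ↦ (cdf_eq_real ν y).symm
  simp only [qf_of_ne_zero ν h0.ne', hF]
  have hbdd : BddBelow {x : ℝ | t ≤ cdf ν x} := by
    obtain ⟨x₀, hx₀⟩ := ((tendsto_cdf_atBot ν).eventually_lt_const h0).exists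
    refine ⟨x₀, fun y hy ↦ ?_⟩
    by_contra! hlt
    exact absurd (hy.trans (monotone_cdf ν hlt.le)) (not_le.2 hx₀)
  have hne : {x : ℝ | t ≤ cdf ν x}.Nonempty := by
    obtain ⟨x₀, hx₀⟩ := ((tendsto_cdf_atTop ν).eventually_const_lt h1).exists
    exact ⟨x₀, hx₀.le⟩
  refine ⟨fun h ↦ ?_, fun h ↦ csInf_le hbdd h⟩
  have hright : Tendsto (cdf ν) (𝓝[>] x) (𝓝 (cdf ν x)) :=
    ((cdf ν).right_continuous x).mono_left (nhdsWithin_mono _ Ioi_subset_Ici_self)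
  refine ge_of_tendsto hright ?_
  filter_upwards [self_mem_nhdsWithin] with y hy
  obtain ⟨z, hz, hzy⟩ := exists_lt_of_csInf_lt hne (h.trans_lt hy)
  exact le_trans hz (monotone_cdf ν hzy.le)

lemma qf_of_notMem_Icc {t : ℝ} (ht : t ∉ Icc (0 : ℝ) 1) : qf ν t = 0 := by
  have h0 : t ≠ 0 := by
    rintro rfl
    simp at ht
  rw [qf_of_ne_zero ν h0]
  rcases lt_or_ge t 0 with h | h
  · have : {x : ℝ | t ≤ (ν (Iic x)).toReal} = univ :=
      eq_univ_of_forall fun x ↦ h.le.trans ENNReal.toReal_nonneg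
    simp [this]
  · have h1 : 1 < t := by
      by_contra! h1
      exact ht ⟨h, h1⟩
    have : {x : ℝ | t ≤ (ν (Iic x)).toReal} = ∅ :=
      eq_empty_of_forall_notMem fun x hx ↦ absurd (hx.trans measureReal_le_one) (not_le.2 h1)
    simp [this]

lemma measurable_qf : Measurable (qf ν) := by
  have h : Measurable ((Ioo (0 : ℝ) 1).indicator (qf ν)) := by
    refine measurable_of_Iic fun x ↦ ?_
    have : (Ioo (0 : ℝ) 1).indicator (qf ν) ⁻¹' Iic x =
        (Ioo 0 1 ∩ Iic (ν (Iic x)).toReal) ∪ ((Ioo 0 1)ᶜ ∩ {_t | 0 ≤ x}) := by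
      ext t
      by_cases ht : t ∈ Ioo (0 : ℝ) 1
      · simp [ht, qf_le_iff ν ht.1 ht.2, -mem_Ioo]
      · simp [ht, -mem_Ioo]
    rw [this]
    measurability
  have heq : qf ν = fun t ↦ if t = 0 then qf ν 0 else if t = 1 then qf ν 1 else
      (Ioo (0 : ℝ) 1).indicator (qf ν) t := by
    ext t
    split_ifs with h0 h1
    · rw [h0]
    · rw [h1]
    · by_cases ht : t ∈ Ioo (0 : ℝ) 1
      · simp [ht, -mem_Ioo]
      · rw [indicator_of_notMem ht, qf_of_notMem_Icc]
        exact fun h ↦ ht ⟨lt_of_le_of_ne h.1 (Ne.symm h0), lt_of_le_of_ne h.2 h1⟩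
  rw [heq]
  exact Measurable.ite (measurableSet_eq) measurable_const
    (Measurable.ite (measurableSet_eq) measurable_const h)

lemma ae_mem_Ioo_zero_one : ∀ᵐ t ∂(volume.restrict (Icc (0 : ℝ) 1)), t ∈ Ioo (0 : ℝ) 1 := by
  rw [← Measure.restrict_congr_set Ioo_ae_eq_Icc]
  exact ae_restrict_mem measurableSet_Ioo

lemma map_qf : (volume.restrict (Icc (0 : ℝ) 1)).map (qf ν) = ν := by
  refine Measure.ext_of_Iic _ _ fun x ↦ ?_
  rw [Measure.map_apply (measurable_qf ν) measurableSet_Iic]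
  have h : qf ν ⁻¹' Iic x =ᵐ[volume.restrict (Icc (0 : ℝ) 1)]
      Icc 0 (ν (Iic x)).toReal := by
    filter_upwards [ae_mem_Ioo_zero_one] with t ht
    refine propext ⟨fun h ↦ ⟨ht.1.le, (qf_le_iff ν ht.1 ht.2 x).1 h⟩, fun h ↦
      (qf_le_iff ν ht.1 ht.2 x).2 h.2⟩
  rw [measure_congr h, Measure.restrict_apply measurableSet_Icc,
    inter_eq_left.2 (Icc_subset_Icc_right measureReal_le_one : Icc 0 (ν (Iic x)).toReal ⊆ _),
    Real.volume_Icc, sub_zero, ENNReal.ofReal_toReal (measure_ne_top _ _)]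

variable {ν}

lemma integrable_qf (hint : Integrable id ν) : Integrable (qf ν) := by
  have h : IntegrableOn (qf ν) (Icc (0 : ℝ) 1) := by
    rw [← map_qf ν, integrable_map_measure aestronglyMeasurable_id
      (measurable_qf ν).aemeasurable] at hint
    exact hint
  exact h.integrable_of_forall_notMem_eq_zero fun t ht ↦ qf_of_notMem_Icc ν ht

lemma integral_qf : ∫ t in (0 : ℝ)..1, qf ν t = ∫ x, x ∂ν := by
  conv_rhs => rw [← map_qf ν]
  rw [integral_map (f := fun x ↦ x) (measurable_qf ν).aemeasurable aestronglyMeasurable_id,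
    intervalIntegral.integral_of_le zero_le_one, integral_Icc_eq_integral_Ioc]

variable (ν) (μ : ℝ)

lemma nuM_le_nuP : nuM ν μ ≤ nuP ν μ :=
  ENNReal.toReal_mono (measure_ne_top _ _) (measure_mono Iio_subset_Iic_self)

lemma nuP_le_one : nuP ν μ ≤ 1 := measureReal_le_one

lemma measure_Iic_toReal_le_nuM {x : ℝ} (hx : x < μ) : (ν (Iic x)).toReal ≤ nuM ν μ :=
  ENNReal.toReal_mono (measure_ne_top _ _) (measure_mono (Iic_subset_Iio.2 hx))

variable {μ}

lemma qf_lt_of_lt_nuM {t : ℝ} (h0 : 0 < t) (ht : t < nuM ν μ) : qf ν t < μ := by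
  have h1 : t < 1 := ht.trans_le ((nuM_le_nuP ν μ).trans (nuP_le_one ν μ))
  obtain ⟨u, hu, huμ, hlim⟩ := exists_seq_strictMono_tendsto μ
  have hU : ⋃ n, Iic (u n) = Iio μ := by
    ext x
    simp only [mem_iUnion, mem_Iic, mem_Iio]
    refine ⟨fun ⟨n, hn⟩ ↦ hn.trans_lt (huμ n), fun hx ↦ ?_⟩
    obtain ⟨n, hn⟩ := (hlim.eventually_const_lt hx).exists
    exact ⟨n, hn.le⟩
  have hmono : Monotone fun n ↦ Iic (u n) := fun m n h ↦ Iic_subset_Iic.2 (hu.monotone h)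
  have hconv := tendsto_measure_iUnion_atTop (μ := ν) hmono
  rw [hU] at hconv
  have hconv' := (ENNReal.tendsto_toReal (measure_ne_top ν (Iio μ))).comp hconv
  obtain ⟨n, hn⟩ := (hconv'.eventually_const_lt ht).exists
  exact ((qf_le_iff ν h0 h1 _).2 (le_of_lt hn)).trans_lt (huμ n)

lemma lt_qf_of_nuP_lt {t : ℝ} (ht : nuP ν μ < t) (h1 : t < 1) : μ < qf ν t := by
  have h0 : 0 < t := ((nuM_nonneg ν μ).trans (nuM_le_nuP ν μ)).trans_lt ht
  rw [← not_le, qf_le_iff ν h0 h1]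
  exact not_le.2 ht

lemma qf_eq_of_mem_Ioc {t : ℝ} (ht : t ∈ Ioc (nuM ν μ) (nuP ν μ)) : qf ν t = μ := by
  rw [qf_of_ne_zero ν ((nuM_nonneg ν μ).trans_lt ht.1).ne']
  refine IsLeast.csInf_eq ⟨ht.2, fun x hx ↦ ?_⟩
  by_contra! hlt
  exact absurd (hx.trans (measure_Iic_toReal_le_nuM ν μ hlt)) (not_le.2 ht.1)

end Quantile

section Primitive

variable {ν : Measure ℝ} [IsProbabilityMeasure ν] {μ : ℝ}

lemma intervalIntegrable_qf_sub (hint : Integrable id ν) (a b : ℝ) :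
    IntervalIntegrable (fun t ↦ qf ν t - μ) volume a b :=
  (integrable_qf hint).intervalIntegrable.sub intervalIntegrable_const

lemma Hfun_sub_Hfun (hint : Integrable id ν) (a b : ℝ) :
    Hfun ν μ b - Hfun ν μ a = ∫ t in a..b, (qf ν t - μ) :=
  intervalIntegral.integral_interval_sub_left (intervalIntegrable_qf_sub hint _ _)
    (intervalIntegrable_qf_sub hint _ _)

lemma continuous_Hfun (hint : Integrable id ν) : Continuous (Hfun ν μ) :=
  intervalIntegral.continuous_primitive (intervalIntegrable_qf_sub hint) 0

lemma Hfun_zero (ν : Measure ℝ) (μ : ℝ) : Hfun ν μ 0 = 0 := intervalIntegral.integral_same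

lemma Hfun_one (hint : Integrable id ν) (hμ : μ = ∫ x, x ∂ν) : Hfun ν μ 1 = 0 := by
  rw [Hfun, intervalIntegral.integral_sub (integrable_qf hint).intervalIntegrable
    intervalIntegrable_const, integral_qf, hμ]
  simp

lemma strictAntiOn_Hfun (hint : Integrable id ν) :
    StrictAntiOn (Hfun ν μ) (Icc 0 (nuM ν μ)) := by
  intro a ha b hb hab
  rw [← sub_pos, ← neg_sub, Hfun_sub_Hfun hint, ← intervalIntegral.integral_neg]
  refine intervalIntegral.intervalIntegral_pos_of_pos_on
    (intervalIntegrable_qf_sub hint a b).neg (fun t ht ↦ ?_) hab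
  have := qf_lt_of_lt_nuM ν (ha.1.trans_lt ht.1) (ht.2.trans_le hb.2)
  linarith

lemma strictMonoOn_Hfun (hint : Integrable id ν) :
    StrictMonoOn (Hfun ν μ) (Icc (nuP ν μ) 1) := by
  intro a ha b hb hab
  rw [← sub_pos, Hfun_sub_Hfun hint]
  refine intervalIntegral.intervalIntegral_pos_of_pos_on
    (intervalIntegrable_qf_sub hint a b) (fun t ht ↦ ?_) hab
  have := lt_qf_of_nuP_lt ν (ha.1.trans_lt ht.1) (ht.2.trans_le hb.2)
  linarith

lemma Hfun_eq_cval (hint : Integrable id ν) {t : ℝ} (ht : t ∈ Icc (nuM ν μ) (nuP ν μ)) :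
    Hfun ν μ t = cval ν μ := by
  rw [← sub_eq_zero, cval, Hfun_sub_Hfun hint]
  refine intervalIntegral.integral_zero_ae (Eventually.of_forall fun u hu ↦ ?_)
  rw [uIoc_of_le ht.1] at hu
  rw [qf_eq_of_mem_Ioc ν ⟨hu.1, hu.2.trans ht.2⟩, sub_self]

lemma Hfun_nuP (hint : Integrable id ν) : Hfun ν μ (nuP ν μ) = cval ν μ :=
  Hfun_eq_cval hint (right_mem_Icc.2 (nuM_le_nuP ν μ))

lemma exists_Hfun_eq (hint : Integrable id ν) (hμ : μ = ∫ x, x ∂ν) {s : ℝ}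
    (hs : s ∈ Icc (cval ν μ) 0) :
    ∃ a ∈ Icc 0 (nuM ν μ), ∃ b ∈ Icc (nuP ν μ) 1, Hfun ν μ a = s ∧ Hfun ν μ b = s := by
  have hc := continuous_Hfun (μ := μ) hint
  obtain ⟨a, ha, has⟩ := intermediate_value_Icc' (nuM_nonneg ν μ) hc.continuousOn
    (show s ∈ Icc (Hfun ν μ (nuM ν μ)) (Hfun ν μ 0) by rwa [Hfun_zero])
  obtain ⟨b, hb, hbs⟩ := intermediate_value_Icc (nuP_le_one ν μ) hc.continuousOn
    (show s ∈ Icc (Hfun ν μ (nuP ν μ)) (Hfun ν μ 1) by rwa [Hfun_one hint hμ, Hfun_nuP hint])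
  exact ⟨a, ha, b, hb, has, hbs⟩

lemma Hfun_mem_Icc (hint : Integrable id ν) (hμ : μ = ∫ x, x ∂ν) {t : ℝ}
    (ht : t ∈ Icc (0 : ℝ) 1) : Hfun ν μ t ∈ Icc (cval ν μ) 0 := by
  have h0 := nuM_nonneg ν μ
  have h1 := nuP_le_one ν μ
  have h01 := nuM_le_nuP ν μ
  have hanti := (strictAntiOn_Hfun (μ := μ) hint).antitoneOn
  have hmono := (strictMonoOn_Hfun (μ := μ) hint).monotoneOn
  have hc0 : cval ν μ ≤ 0 := by
    rw [← Hfun_zero ν μ]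
    exact hanti (left_mem_Icc.2 h0) (right_mem_Icc.2 h0) h0
  rcases le_total t (nuM ν μ) with h | h
  · refine ⟨hanti ⟨ht.1, h⟩ (right_mem_Icc.2 h0) h, ?_⟩
    rw [← Hfun_zero ν μ]
    exact hanti (left_mem_Icc.2 h0) ⟨ht.1, h⟩ ht.1
  rcases le_total t (nuP ν μ) with h' | h'
  · rw [Hfun_eq_cval hint ⟨h, h'⟩]
    exact left_mem_Icc.2 hc0
  · rw [← Hfun_nuP hint, ← Hfun_one hint hμ]
    exact ⟨hmono (left_mem_Icc.2 h1) ⟨h', ht.2⟩ h', hmono ⟨h', ht.2⟩ (right_mem_Icc.2 h1) ht.2⟩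

/-- Sublevel sets of `H` are intervals whose endpoints lie at the level itself. -/
lemma setOf_Hfun_le_eq_Icc (hint : Integrable id ν) {a b s : ℝ} (ha : a ∈ Icc 0 (nuM ν μ))
    (hb : b ∈ Icc (nuP ν μ) 1) (has : Hfun ν μ a = s) (hbs : Hfun ν μ b = s) :
    Icc 0 1 ∩ Hfun ν μ ⁻¹' Iic s = Icc a b := by
  have h0 := nuM_nonneg ν μ
  have h1 := nuP_le_one ν μ
  have h01 := nuM_le_nuP ν μ
  have hanti := strictAntiOn_Hfun (μ := μ) hint
  have hmono := strictMonoOn_Hfun (μ := μ) hint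
  have hcs : cval ν μ ≤ s := has ▸ hanti.antitoneOn ha (right_mem_Icc.2 h0) ha.2
  have key : ∀ t ∈ Icc (0 : ℝ) 1, Hfun ν μ t ≤ s ↔ t ∈ Icc a b := by
    intro t ht
    rcases le_total t (nuM ν μ) with h | h
    · rw [← has, hanti.le_iff_ge ⟨ht.1, h⟩ ha]
      exact ⟨fun h' ↦ ⟨h', h.trans (h01.trans hb.1)⟩, fun h' ↦ h'.1⟩
    rcases le_total t (nuP ν μ) with h' | h'
    · rw [Hfun_eq_cval hint ⟨h, h'⟩]
      exact ⟨fun _ ↦ ⟨ha.2.trans h, h'.trans hb.1⟩, fun _ ↦ hcs⟩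
    · rw [← hbs, hmono.le_iff_le ⟨h', ht.2⟩ hb]
      exact ⟨fun h'' ↦ ⟨ha.2.trans h, h''⟩, fun h'' ↦ h''.2⟩
  ext t
  exact ⟨fun h ↦ (key t h.1).1 h.2, fun h ↦
    have ht : t ∈ Icc (0 : ℝ) 1 := ⟨ha.1.trans h.1, h.2.trans hb.2⟩
    ⟨ht, (key t ht).2 h⟩⟩

lemma Afun_Hfun (hint : Integrable id ν) {t : ℝ} (ht : t ∈ Ico 0 (nuM ν μ)) :
    Afun ν μ (Hfun ν μ t) = t := by
  have hanti := strictAntiOn_Hfun (μ := μ) hint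
  have ht' := Ico_subset_Icc_self ht
  have hne : Hfun ν μ t ≠ cval ν μ :=
    (hanti ht' (right_mem_Icc.2 (nuM_nonneg ν μ)) ht.2).ne'
  rw [Afun, if_neg hne]
  exact IsLeast.csInf_eq ⟨⟨ht', le_rfl⟩, fun x hx ↦ (hanti.le_iff_ge hx.1 ht').1 hx.2⟩

lemma Bfun_Hfun (hint : Integrable id ν) {t : ℝ} (ht : t ∈ Ioc (nuP ν μ) 1) :
    Bfun ν μ (Hfun ν μ t) = t := by
  have hmono := strictMonoOn_Hfun (μ := μ) hint
  have ht' := Ioc_subset_Icc_self ht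
  have hne : Hfun ν μ t ≠ cval ν μ := by
    rw [← Hfun_nuP hint]
    exact (hmono (left_mem_Icc.2 (nuP_le_one ν μ)) ht' ht.1).ne'
  rw [Bfun, if_neg hne]
  exact IsLeast.csInf_eq ⟨⟨ht', le_rfl⟩, fun x hx ↦ (hmono.le_iff_le ht' hx.1).1 hx.2⟩

/-- Above its minimum, each level of `H` is attained at exactly one point on either side. -/
lemma exists_Hfun_eq_of_lt (hint : Integrable id ν) (hμ : μ = ∫ x, x ∂ν) {s : ℝ}
    (hs : s ∈ Ioc (cval ν μ) 0) :
    ∃ a ∈ Ico 0 (nuM ν μ), ∃ b ∈ Ioc (nuP ν μ) 1, Hfun ν μ a = s ∧ Hfun ν μ b = s := by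
  obtain ⟨a, ha, b, hb, has, hbs⟩ := exists_Hfun_eq hint hμ (Ioc_subset_Icc_self hs)
  refine ⟨a, ⟨ha.1, lt_of_le_of_ne ha.2 ?_⟩, b, ⟨lt_of_le_of_ne hb.1 ?_, hb.2⟩, has, hbs⟩
  · rintro rfl
    exact hs.1.ne has
  · rintro rfl
    exact hs.1.ne ((Hfun_nuP hint).symm.trans hbs)

lemma measurable_Afun (hint : Integrable id ν) : Measurable (Afun ν μ) := by
  have h0 := nuM_nonneg ν μ
  have hanti : Antitone fun s ↦
      sInf {t : ℝ | t ∈ Icc 0 (nuM ν μ) ∧ Hfun ν μ t ≤ max s (cval ν μ)} := fun x y hxy ↦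
    csInf_le_csInf ⟨0, fun t ht ↦ ht.1.1⟩
      ⟨nuM ν μ, right_mem_Icc.2 h0, le_max_right x (cval ν μ)⟩
      fun t ht ↦ ⟨ht.1, ht.2.trans (max_le_max_right _ hxy)⟩
  have heq : Afun ν μ = fun s ↦ if s = cval ν μ then nuP ν μ else if cval ν μ ≤ s then
      sInf {t : ℝ | t ∈ Icc 0 (nuM ν μ) ∧ Hfun ν μ t ≤ max s (cval ν μ)} else 0 := by
    ext s
    unfold Afun
    split_ifs with h h'
    · rfl
    · rw [max_eq_left h']
    · convert Real.sInf_empty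
      refine eq_empty_of_forall_notMem fun t ht ↦ h' (le_trans ?_ ht.2)
      exact (strictAntiOn_Hfun hint).antitoneOn ht.1 (right_mem_Icc.2 h0) ht.1.2
  rw [heq]
  exact Measurable.ite measurableSet_eq measurable_const
    (Measurable.ite measurableSet_Ici hanti.measurable measurable_const)

lemma measurable_Bfun (hint : Integrable id ν) (hμ : μ = ∫ x, x ∂ν) :
    Measurable (Bfun ν μ) := by
  have h1 := nuP_le_one ν μ
  have hH1 := Hfun_one hint hμ
  have hmono : Monotone fun s ↦
      sInf {t : ℝ | t ∈ Icc (nuP ν μ) 1 ∧ min s 0 ≤ Hfun ν μ t} := fun x y hxy ↦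
    csInf_le_csInf ⟨nuP ν μ, fun t ht ↦ ht.1.1⟩
      ⟨1, right_mem_Icc.2 h1, by simp [hH1]⟩
      fun t ht ↦ ⟨ht.1, (min_le_min_right _ hxy).trans ht.2⟩
  have heq : Bfun ν μ = fun s ↦ if s = cval ν μ then nuP ν μ else if s ≤ 0 then
      sInf {t : ℝ | t ∈ Icc (nuP ν μ) 1 ∧ min s 0 ≤ Hfun ν μ t} else 0 := by
    ext s
    unfold Bfun
    split_ifs with h h'
    · rfl
    · rw [min_eq_left h']
    · convert Real.sInf_empty
      refine eq_empty_of_forall_notMem fun t ht ↦ h' (ht.2.trans ?_)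
      rw [← hH1]
      exact (strictMonoOn_Hfun hint).monotoneOn ht.1 (right_mem_Icc.2 h1) ht.1.2
  rw [heq]
  exact Measurable.ite measurableSet_eq measurable_const
    (Measurable.ite measurableSet_Iic hmono.measurable measurable_const)

end Primitive

section Level

variable {ν : Measure ℝ} [IsProbabilityMeasure ν] {μ : ℝ}

/-- The law of `H` under the uniform distribution on `[0,1]`. -/
noncomputable def levelDist (ν : Measure ℝ) (μ : ℝ) : Measure ℝ :=
  (volume.restrict (Icc (0 : ℝ) 1)).map (Hfun ν μ)

instance isProbabilityMeasure_volume_restrict_Icc_zero_one :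
    IsProbabilityMeasure (volume.restrict (Icc (0 : ℝ) 1)) :=
  ⟨by simp⟩

lemma isProbabilityMeasure_levelDist (hint : Integrable id ν) :
    IsProbabilityMeasure (levelDist ν μ) :=
  Measure.isProbabilityMeasure_map (continuous_Hfun hint).aemeasurable

/-- `[0,1] ∩ {H ≤ s}` is either empty or an interval with endpoints at equal level. -/
lemma setOf_Hfun_le_cases (hint : Integrable id ν) (hμ : μ = ∫ x, x ∂ν) (s : ℝ) :
    Icc 0 1 ∩ Hfun ν μ ⁻¹' Iic s = ∅ ∨ ∃ a b, a ≤ b ∧ Hfun ν μ a = Hfun ν μ b ∧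
      Icc 0 1 ∩ Hfun ν μ ⁻¹' Iic s = Icc a b := by
  rcases lt_or_ge s (cval ν μ) with hs | hs
  · left
    exact eq_empty_of_forall_notMem fun t ht ↦
      absurd ((Hfun_mem_Icc hint hμ ht.1).1.trans ht.2) (not_le.2 hs)
  right
  rcases le_total s 0 with hs0 | hs0
  · obtain ⟨a, ha, b, hb, has, hbs⟩ := exists_Hfun_eq hint hμ ⟨hs, hs0⟩
    exact ⟨a, b, ha.2.trans ((nuM_le_nuP ν μ).trans hb.1), has.trans hbs.symm,
      setOf_Hfun_le_eq_Icc hint ha hb has hbs⟩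
  · refine ⟨0, 1, zero_le_one, by rw [Hfun_zero, Hfun_one hint hμ], inter_eq_left.2 fun t ht ↦ ?_⟩
    exact (Hfun_mem_Icc hint hμ ht).2.trans hs0

lemma Kfun_eq_levelDist_Iic (hint : Integrable id ν) (hμ : μ = ∫ x, x ∂ν) (s : ℝ) :
    Kfun ν μ s = (levelDist ν μ (Iic s)).toReal := by
  have h0 := nuM_nonneg ν μ
  have h1 := nuP_le_one ν μ
  have h01 := nuM_le_nuP ν μ
  rw [levelDist, Measure.map_apply (continuous_Hfun hint).measurable measurableSet_Iic,
    Measure.restrict_apply ((continuous_Hfun hint).measurable measurableSet_Iic), inter_comm]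
  unfold Kfun
  split_ifs with hs hs' hs''
  · rw [inter_eq_left.2 (show Icc 0 1 ⊆ Hfun ν μ ⁻¹' Iic s from
      fun t ht ↦ (Hfun_mem_Icc hint hμ ht).2.trans hs.le)]
    simp
  · have : Icc 0 1 ∩ Hfun ν μ ⁻¹' Iic s = ∅ := eq_empty_of_forall_notMem fun t ht ↦
      absurd ((Hfun_mem_Icc hint hμ ht.1).1.trans ht.2) (not_le.2 hs')
    simp [this]
  · rw [setOf_Hfun_le_eq_Icc hint (right_mem_Icc.2 h0) (left_mem_Icc.2 h1) hs''.symm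
      ((Hfun_nuP hint).trans hs''.symm), Real.volume_Icc, ENNReal.toReal_ofReal (sub_nonneg.2 h01)]
  · obtain ⟨a, ha, b, hb, has, hbs⟩ := exists_Hfun_eq_of_lt hint hμ
      ⟨lt_of_le_of_ne (not_lt.1 hs') (Ne.symm hs''), not_lt.1 hs⟩
    rw [setOf_Hfun_le_eq_Icc hint (Ico_subset_Icc_self ha) (Ioc_subset_Icc_self hb) has hbs,
      Real.volume_Icc, ENNReal.toReal_ofReal (by linarith [ha.2, hb.1])]
    nth_rw 1 [← hbs]
    rw [← has, Afun_Hfun hint ha, Bfun_Hfun hint hb]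

lemma residualDist_eq_map (hint : Integrable id ν) (hμ : μ = ∫ x, x ∂ν) :
    residualDist ν μ = (volume.restrict (Icc (0 : ℝ) 1)).map fun t ↦
      qf ν (Bfun ν μ (Hfun ν μ t)) - qf ν (Afun ν μ (Hfun ν μ t)) := by
  have := isProbabilityMeasure_levelDist (μ := μ) hint
  have hg : Measurable fun s ↦ qf ν (Bfun ν μ s) - qf ν (Afun ν μ s) :=
    ((measurable_qf ν).comp (measurable_Bfun hint hμ)).sub
      ((measurable_qf ν).comp (measurable_Afun hint))
  have hae : residualRV ν μ =ᵐ[volume.restrict (Icc (0 : ℝ) 1)]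
      (fun s ↦ qf ν (Bfun ν μ s) - qf ν (Afun ν μ s)) ∘ qf (levelDist ν μ) := by
    filter_upwards [ae_mem_Ioo_zero_one] with t ht
    have : Kinv ν μ t = qf (levelDist ν μ) t := by
      simp only [qf_of_ne_zero _ ht.1.ne', Kinv, Kfun_eq_levelDist_Iic hint hμ]
    simp [residualRV, this]
  rw [residualDist, Measure.map_congr hae, ← Measure.map_map hg (measurable_qf _), map_qf,
    levelDist, Measure.map_map hg (continuous_Hfun hint).measurable]
  rfl

/-- Positive and negative parts of `F⁻¹ - μ` put the same mass on each level of `H`. -/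
lemma lintegral_comp_Hfun_mul (hint : Integrable id ν) (hμ : μ = ∫ x, x ∂ν)
    {f : ℝ → ENNReal} (hf : Measurable f) :
    ∫⁻ t in Icc (0 : ℝ) 1, f (Hfun ν μ t) * ENNReal.ofReal (qf ν t - μ) =
      ∫⁻ t in Icc (0 : ℝ) 1, f (Hfun ν μ t) * ENNReal.ofReal (μ - qf ν t) := by
  have hH : Measurable (Hfun ν μ) := (continuous_Hfun hint).measurable
  have hp : Measurable fun t ↦ ENNReal.ofReal (qf ν t - μ) :=
    ((measurable_qf ν).sub_const μ).ennreal_ofReal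
  have hn : Measurable fun t ↦ ENNReal.ofReal (μ - qf ν t) :=
    ((measurable_qf ν).const_sub μ).ennreal_ofReal
  have hI : IntegrableOn (fun t ↦ qf ν t - μ) (Icc 0 1) :=
    (integrable_qf hint).integrableOn.sub continuousOn_const.integrableOn_Icc
  have hIn : IntegrableOn (fun t ↦ μ - qf ν t) (Icc 0 1) :=
    Integrable.sub continuousOn_const.integrableOn_Icc (integrable_qf hint).integrableOn
  have hfin := isFiniteMeasure_withDensity_ofReal hI.2
  have hfin' := isFiniteMeasure_withDensity_ofReal hIn.2
  have key : ((volume.restrict (Icc (0 : ℝ) 1)).withDensity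
        fun t ↦ ENNReal.ofReal (qf ν t - μ)).map (Hfun ν μ) =
      ((volume.restrict (Icc (0 : ℝ) 1)).withDensity
        fun t ↦ ENNReal.ofReal (μ - qf ν t)).map (Hfun ν μ) := by
    refine Measure.ext_of_Iic _ _ fun s ↦ ?_
    have hs := hH (measurableSet_Iic (a := s))
    rw [Measure.map_apply hH measurableSet_Iic, Measure.map_apply hH measurableSet_Iic,
      withDensity_apply _ hs, withDensity_apply _ hs, Measure.restrict_restrict hs, inter_comm]
    rcases setOf_Hfun_le_cases hint hμ s with h | ⟨a, b, hab, hHab, h⟩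
    · simp [h]
    rw [h]
    have hI' : IntegrableOn (fun t ↦ qf ν t - μ) (Icc a b) := hI.mono_set (h ▸ inter_subset_left)
    have hzero : ∫ t in Icc a b, (qf ν t - μ) = 0 := by
      rw [integral_Icc_eq_integral_Ioc, ← intervalIntegral.integral_of_le hab,
        ← Hfun_sub_Hfun hint, hHab, sub_self]
    rw [integral_eq_lintegral_pos_part_sub_lintegral_neg_part hI', sub_eq_zero] at hzero
    have hne : ∀ {g : ℝ → ℝ}, IntegrableOn g (Icc a b) →
        ∫⁻ t in Icc a b, ENNReal.ofReal (g t) ≠ ⊤ := fun hg ↦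
      (hg.lintegral_lt_top).ne
    have := (ENNReal.toReal_eq_toReal_iff' (hne hI') (hne hI'.neg)).1 hzero
    simpa using this
  have h := congrArg (fun m ↦ ∫⁻ s, f s ∂m) key
  simp only [lintegral_map hf hH] at h
  have hfH : Measurable fun t ↦ f (Hfun ν μ t) := hf.comp hH
  rw [lintegral_withDensity_eq_lintegral_mul _ hp hfH,
    lintegral_withDensity_eq_lintegral_mul _ hn hfH] at h
  simpa [mul_comm] using h

end Level

section Rotation

lemma fract_add_sub_fract {u : ℝ} (h0 : 0 ≤ u) (h1 : u ≤ 1) (x : ℝ) :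
    Int.fract (x + u) - Int.fract x = u - if 1 - u ≤ Int.fract x then 1 else 0 := by
  have hx0 := Int.fract_nonneg x
  have hx1 := Int.fract_lt_one x
  have hx := Int.self_sub_floor x
  rw [sub_eq_iff_eq_add, Int.fract_eq_iff]
  split_ifs with h
  · refine ⟨by linarith, by linarith, ⌊x⌋ + 1, ?_⟩
    push_cast
    linarith
  · exact ⟨by linarith, by linarith, ⌊x⌋, by linarith⟩

/-- The two-valued sequence driven by a rotation by `u` has partial sums within `b - a` of
their mean. -/
lemma abs_sum_rotation_sub_le {a b u m : ℝ} (h0 : 0 ≤ u) (h1 : u ≤ 1) (hab : a ≤ b)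
    (hm : m = a + u * (b - a)) (v : ℝ) (n : ℕ) :
    |(∑ i ∈ Finset.range n, if 1 - u ≤ Int.fract (i * u + v) then b else a) - n * m| ≤ b - a := by
  have hsum : (∑ i ∈ Finset.range n, if 1 - u ≤ Int.fract (i * u + v) then b else a) - n * m =
      (b - a) * (Int.fract v - Int.fract (n * u + v)) := by
    induction n with
    | zero => simp
    | succ n ih =>
      have h := fract_add_sub_fract h0 h1 (n * u + v)
      have hn : ((n + 1 : ℕ) : ℝ) * u + v = n * u + v + u := by push_cast; ring
      rw [Finset.sum_range_succ, hn]
      push_cast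
      have hstep : (if 1 - u ≤ Int.fract (n * u + v) then b else a) =
          a + (b - a) * if 1 - u ≤ Int.fract (n * u + v) then 1 else 0 := by
        split_ifs <;> ring
      rw [hstep]
      linear_combination ih + (b - a) * h - hm
  rw [hsum, abs_mul, abs_of_nonneg (sub_nonneg.2 hab)]
  refine mul_le_of_le_one_right (sub_nonneg.2 hab) ?_
  have := Int.fract_nonneg v
  have := Int.fract_lt_one v
  have := Int.fract_nonneg (n * u + v)
  have := Int.fract_lt_one (n * u + v)
  rw [abs_le]
  constructor <;> linarith

lemma measurableSet_le_fract (r x : ℝ) : MeasurableSet {v : ℝ | r ≤ Int.fract (x + v)} :=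
  measurableSet_le measurable_const (measurable_fract.comp (measurable_const_add x))

lemma volume_restrict_le_fract {u : ℝ} (h1 : u ≤ 1) (x : ℝ) :
    volume.restrict (Icc (0 : ℝ) 1) {v | 1 - u ≤ Int.fract (x + v)} = ENNReal.ofReal u := by
  have hreal : ∀ y : ℝ, (volume.restrict (Icc (0 : ℝ) 1)).real {v | 1 - u ≤ Int.fract (y + v)} =
      ∫ v in y..y + 1, {v : ℝ | 1 - u ≤ Int.fract v}.indicator 1 v := by
    intro y
    rw [← integral_indicator_one (measurableSet_le_fract _ y), integral_Icc_eq_integral_Ioc,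
      ← intervalIntegral.integral_of_le zero_le_one]
    have := intervalIntegral.integral_comp_add_left (a := 0) (b := 1)
      ({v : ℝ | 1 - u ≤ Int.fract v}.indicator (1 : ℝ → ℝ)) y
    rw [add_zero] at this
    rw [← this]
    rfl
  have hper : Function.Periodic ({v : ℝ | 1 - u ≤ Int.fract v}.indicator (1 : ℝ → ℝ)) 1 := by
    intro v
    simp [indicator_apply]
  have hshift := (hreal x).trans ((hper.intervalIntegral_add_eq x 0).trans (hreal 0).symm)
  have hzero : volume.restrict (Icc (0 : ℝ) 1) {v | 1 - u ≤ Int.fract (0 + v)} =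
      ENNReal.ofReal u := by
    have : {v : ℝ | 1 - u ≤ Int.fract (0 + v)} =ᵐ[volume.restrict (Icc (0 : ℝ) 1)]
        Icc (1 - u) 1 := by
      filter_upwards [ae_mem_Ioo_zero_one] with v hv
      refine propext ?_
      change 1 - u ≤ Int.fract (0 + v) ↔ v ∈ Icc (1 - u) 1
      rw [zero_add, Int.fract_eq_self.2 ⟨hv.1.le, hv.2⟩]
      exact ⟨fun h ↦ ⟨h, hv.2.le⟩, fun h ↦ h.1⟩
    rw [measure_congr this, Measure.restrict_apply measurableSet_Icc,
      inter_eq_left.2 (Icc_subset_Icc_left (by linarith)), Real.volume_Icc, sub_sub_cancel]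
  rw [← hzero]
  exact (measureReal_eq_measureReal_iff).1 hshift

lemma lintegral_rotation {u : ℝ} (h0 : 0 ≤ u) (h1 : u ≤ 1) (x a b : ℝ) (e : ℝ → ENNReal) :
    ∫⁻ v in Icc (0 : ℝ) 1, e (if 1 - u ≤ Int.fract (x + v) then b else a) =
      ENNReal.ofReal u * e b + ENNReal.ofReal (1 - u) * e a := by
  have hS := measurableSet_le_fract (1 - u) x
  have hvol := volume_restrict_le_fract h1 x
  have hb : ∫⁻ v in {v | 1 - u ≤ Int.fract (x + v)},
      e (if 1 - u ≤ Int.fract (x + v) then b else a) ∂(volume.restrict (Icc (0 : ℝ) 1)) =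
      ∫⁻ _ in {v | 1 - u ≤ Int.fract (x + v)}, e b ∂(volume.restrict (Icc (0 : ℝ) 1)) :=
    setLIntegral_congr_fun hS fun v hv ↦ congrArg e (if_pos hv)
  have ha : ∫⁻ v in {v | 1 - u ≤ Int.fract (x + v)}ᶜ,
      e (if 1 - u ≤ Int.fract (x + v) then b else a) ∂(volume.restrict (Icc (0 : ℝ) 1)) =
      ∫⁻ _ in {v | 1 - u ≤ Int.fract (x + v)}ᶜ, e a ∂(volume.restrict (Icc (0 : ℝ) 1)) :=
    setLIntegral_congr_fun hS.compl fun v hv ↦ congrArg e (if_neg hv)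
  rw [← lintegral_add_compl _ hS, hb, ha, setLIntegral_const, setLIntegral_const,
    prob_compl_eq_one_sub hS, hvol, ENNReal.ofReal_sub _ h0, ENNReal.ofReal_one, mul_comm,
    mul_comm (e a)]

end Rotation

section Construction

variable {ν : Measure ℝ} [IsProbabilityMeasure ν] {μ : ℝ}

lemma measurable_ufun (hint : Integrable id ν) (hμ : μ = ∫ x, x ∂ν) : Measurable (ufun ν μ) := by
  have hA := (measurable_qf ν).comp (measurable_Afun (μ := μ) hint)
  have hB := (measurable_qf ν).comp (measurable_Bfun hint hμ)
  exact Measurable.ite measurableSet_eq measurable_const ((hA.const_sub μ).div (hB.sub hA))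

/-- The values of `F⁻¹` at the two points on the level of `H` through a given point. -/
lemma ae_level_cases (hint : Integrable id ν) (hμ : μ = ∫ x, x ∂ν) :
    ∀ᵐ t ∂(volume.restrict (Icc (0 : ℝ) 1)),
      (qf ν (Afun ν μ (Hfun ν μ t)) = μ ∧ qf ν (Bfun ν μ (Hfun ν μ t)) = μ ∧ qf ν t = μ ∧
        ufun ν μ (Hfun ν μ t) = 1 / 2) ∨
      (qf ν (Afun ν μ (Hfun ν μ t)) < μ ∧ μ < qf ν (Bfun ν μ (Hfun ν μ t)) ∧
        ufun ν μ (Hfun ν μ t) = (μ - qf ν (Afun ν μ (Hfun ν μ t))) /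
          (qf ν (Bfun ν μ (Hfun ν μ t)) - qf ν (Afun ν μ (Hfun ν μ t))) ∧
        (qf ν t = qf ν (Afun ν μ (Hfun ν μ t)) ∨ qf ν t = qf ν (Bfun ν μ (Hfun ν μ t)))) := by
  have hneM : ∀ᵐ t ∂(volume.restrict (Icc (0 : ℝ) 1)), t ≠ nuM ν μ :=
    ae_restrict_of_ae (Measure.ae_ne volume _)
  have hneP : ∀ᵐ t ∂(volume.restrict (Icc (0 : ℝ) 1)), t ≠ nuP ν μ :=
    ae_restrict_of_ae (Measure.ae_ne volume _)
  have hanti := strictAntiOn_Hfun (μ := μ) hint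
  have hmono := strictMonoOn_Hfun (μ := μ) hint
  filter_upwards [ae_mem_Ioo_zero_one, hneM, hneP] with t ht htM htP
  by_cases hmid : t ∈ Ioc (nuM ν μ) (nuP ν μ)
  · left
    have hH := Hfun_eq_cval hint (Ioc_subset_Icc_self hmid)
    have hq := qf_eq_of_mem_Ioc ν ⟨hmid.1.trans_le hmid.2, le_rfl⟩
    simp [hH, Afun, Bfun, ufun, hq, qf_eq_of_mem_Ioc ν hmid]
  right
  have hside : t ∈ Ico 0 (nuM ν μ) ∨ t ∈ Ioc (nuP ν μ) 1 := by
    by_contra! h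
    refine hmid ⟨lt_of_le_of_ne (not_lt.1 fun h' ↦ h.1 ⟨ht.1.le, h'⟩) htM.symm,
      not_lt.1 fun h' ↦ h.2 ⟨h', ht.2.le⟩⟩
  have hs : Hfun ν μ t ∈ Ioo (cval ν μ) 0 := by
    rcases hside with h | h
    · rw [← Hfun_zero ν μ]
      exact ⟨hanti ⟨h.1, h.2.le⟩ (right_mem_Icc.2 (nuM_nonneg ν μ)) h.2,
        hanti (left_mem_Icc.2 (nuM_nonneg ν μ)) ⟨h.1, h.2.le⟩ ht.1⟩
    · rw [← Hfun_one hint hμ, ← Hfun_nuP hint]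
      exact ⟨hmono (left_mem_Icc.2 (nuP_le_one ν μ)) ⟨h.1.le, h.2⟩ h.1,
        hmono ⟨h.1.le, h.2⟩ (right_mem_Icc.2 (nuP_le_one ν μ)) ht.2⟩
  obtain ⟨a, ha, b, hb, has, hbs⟩ := exists_Hfun_eq_of_lt hint hμ (Ioo_subset_Ioc_self hs)
  have hA : Afun ν μ (Hfun ν μ t) = a := by rw [← has, Afun_Hfun hint ha]
  have hB : Bfun ν μ (Hfun ν μ t) = b := by rw [← hbs, Bfun_Hfun hint hb]
  have ha0 : 0 < a := lt_of_le_of_ne ha.1 fun h ↦ by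
    rw [← h, Hfun_zero] at has
    exact hs.2.ne has.symm
  have hb1 : b < 1 := lt_of_le_of_ne hb.2 fun h ↦ by
    rw [h, Hfun_one hint hμ] at hbs
    exact hs.2.ne hbs.symm
  refine ⟨hA ▸ qf_lt_of_lt_nuM ν ha0 ha.2, hB ▸ lt_qf_of_nuP_lt ν hb.1 hb1, ?_, ?_⟩
  · rw [ufun, if_neg hs.1.ne']
  · exact hside.imp (fun h ↦ by rw [Afun_Hfun hint h]) (fun h ↦ by rw [Bfun_Hfun hint h])

/-- Given the level `H(ω₁)`, the sequence takes the two values of `F⁻¹` on that level, choosing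
between them by a rotation started at `ω₂`. -/
noncomputable def rotationRV (ν : Measure ℝ) (μ : ℝ) (i : ℕ) (ω : ℝ × ℝ) : ℝ :=
  if 1 - ufun ν μ (Hfun ν μ ω.1) ≤ Int.fract (i * ufun ν μ (Hfun ν μ ω.1) + ω.2) then
    qf ν (Bfun ν μ (Hfun ν μ ω.1)) else qf ν (Afun ν μ (Hfun ν μ ω.1))

lemma measurable_rotationRV (hint : Integrable id ν) (hμ : μ = ∫ x, x ∂ν) (i : ℕ) :
    Measurable (rotationRV ν μ i) := by
  have hH : Measurable fun ω : ℝ × ℝ ↦ Hfun ν μ ω.1 :=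
    (continuous_Hfun hint).measurable.comp measurable_fst
  have hu := (measurable_ufun hint hμ).comp hH
  exact Measurable.ite (measurableSet_le (hu.const_sub 1)
      (((hu.const_mul (i : ℝ)).add measurable_snd).fract))
    ((measurable_qf ν).comp ((measurable_Bfun hint hμ).comp hH))
    ((measurable_qf ν).comp ((measurable_Afun hint).comp hH))

lemma two_point_exchange {a b m x : ℝ} (ha : a < m) (hb : m < b) (hx : x = a ∨ x = b)
    (e : ℝ → ENNReal) :
    ENNReal.ofReal ((m - a) / (b - a)) * e b + ENNReal.ofReal (1 - (m - a) / (b - a)) * e a +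
        (e a * ENNReal.ofReal (b - a)⁻¹ * ENNReal.ofReal (m - x) +
          e b * ENNReal.ofReal (b - a)⁻¹ * ENNReal.ofReal (x - m)) =
      e x + (e a * ENNReal.ofReal (b - a)⁻¹ * ENNReal.ofReal (x - m) +
        e b * ENNReal.ofReal (b - a)⁻¹ * ENNReal.ofReal (m - x)) := by
  have hba : 0 < b - a := by linarith
  set p := ENNReal.ofReal ((m - a) / (b - a)) with hp
  set r := ENNReal.ofReal (1 - (m - a) / (b - a)) with hr
  have hpr : p + r = 1 := by
    rw [hp, hr, ← ENNReal.ofReal_add (by apply div_nonneg <;> linarith)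
      (by rw [sub_nonneg, div_le_one hba]; linarith)]
    simp
  have hwp : ENNReal.ofReal (b - a)⁻¹ * ENNReal.ofReal (m - a) = p := by
    rw [hp, ← ENNReal.ofReal_mul (by positivity), inv_mul_eq_div]
  have hwr : ENNReal.ofReal (b - a)⁻¹ * ENNReal.ofReal (b - m) = r := by
    rw [hr, ← ENNReal.ofReal_mul (by positivity)]
    congr 1
    field_simp
    ring
  rcases hx with rfl | rfl
  · rw [ENNReal.ofReal_of_nonpos (show x - m ≤ 0 by linarith)]
    simp only [mul_assoc, hwp, mul_zero, add_zero, zero_add]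
    calc p * e b + r * e x + e x * p = (p + r) * e x + e b * p := by ring
      _ = _ := by rw [hpr, one_mul]
  · rw [ENNReal.ofReal_of_nonpos (show m - x ≤ 0 by linarith)]
    simp only [mul_assoc, hwr, mul_zero, add_zero, zero_add]
    calc p * e x + r * e a + e x * r = (p + r) * e x + e a * r := by ring
      _ = _ := by rw [hpr, one_mul]

lemma ae_level_mean (hint : Integrable id ν) (hμ : μ = ∫ x, x ∂ν) :
    ∀ᵐ t ∂(volume.restrict (Icc (0 : ℝ) 1)),
      0 ≤ ufun ν μ (Hfun ν μ t) ∧ ufun ν μ (Hfun ν μ t) ≤ 1 ∧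
      qf ν (Afun ν μ (Hfun ν μ t)) ≤ qf ν (Bfun ν μ (Hfun ν μ t)) ∧
      μ = qf ν (Afun ν μ (Hfun ν μ t)) + ufun ν μ (Hfun ν μ t) *
        (qf ν (Bfun ν μ (Hfun ν μ t)) - qf ν (Afun ν μ (Hfun ν μ t))) := by
  filter_upwards [ae_level_cases hint hμ] with t ht
  rcases ht with ⟨ha, hb, -, hu⟩ | ⟨ha, hb, hu, -⟩
  · rw [ha, hb, hu]
    norm_num
  · have hba : 0 < qf ν (Bfun ν μ (Hfun ν μ t)) - qf ν (Afun ν μ (Hfun ν μ t)) := by linarith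
    rw [hu, div_le_one hba, div_mul_cancel₀ _ hba.ne']
    exact ⟨div_nonneg (by linarith) hba.le, by linarith, by linarith, by ring⟩

lemma lintegral_two_point (hint : Integrable id ν) (hμ : μ = ∫ x, x ∂ν) {e : ℝ → ENNReal}
    (he : Measurable e) (he1 : ∀ x, e x ≤ 1) :
    ∫⁻ t in Icc (0 : ℝ) 1, (ENNReal.ofReal (ufun ν μ (Hfun ν μ t)) *
        e (qf ν (Bfun ν μ (Hfun ν μ t))) + ENNReal.ofReal (1 - ufun ν μ (Hfun ν μ t)) *
        e (qf ν (Afun ν μ (Hfun ν μ t)))) = ∫⁻ t in Icc (0 : ℝ) 1, e (qf ν t) := by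
  have hH : Measurable (Hfun ν μ) := (continuous_Hfun hint).measurable
  have hA : Measurable fun s ↦ qf ν (Afun ν μ s) := (measurable_qf ν).comp (measurable_Afun hint)
  have hB : Measurable fun s ↦ qf ν (Bfun ν μ s) :=
    (measurable_qf ν).comp (measurable_Bfun hint hμ)
  set w : ℝ → ENNReal := fun s ↦
    ENNReal.ofReal (qf ν (Bfun ν μ s) - qf ν (Afun ν μ s))⁻¹ with hw
  have hwm : Measurable w := (hB.sub hA).inv.ennreal_ofReal
  have hfa : Measurable fun s ↦ e (qf ν (Afun ν μ s)) * w s := (he.comp hA).mul hwm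
  have hfb : Measurable fun s ↦ e (qf ν (Bfun ν μ s)) * w s := (he.comp hB).mul hwm
  have hn : Measurable fun t ↦ ENNReal.ofReal (μ - qf ν t) :=
    ((measurable_qf ν).const_sub μ).ennreal_ofReal
  have hp : Measurable fun t ↦ ENNReal.ofReal (qf ν t - μ) :=
    ((measurable_qf ν).sub_const μ).ennreal_ofReal
  have hbound : ∀ᵐ t ∂(volume.restrict (Icc (0 : ℝ) 1)),
      w (Hfun ν μ t) * ENNReal.ofReal (μ - qf ν t) ≤ 1 := by
    filter_upwards [ae_level_cases hint hμ] with t ht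
    rcases ht with ⟨-, -, hq, -⟩ | ⟨ha, hb, -, hq⟩
    · simp [hq]
    rw [hw, ← ENNReal.ofReal_mul (by rw [inv_nonneg]; linarith), ENNReal.ofReal_le_one,
      inv_mul_le_one₀ (by linarith)]
    rcases hq with hq | hq <;> linarith
  have hfin : ∀ g : ℝ → ℝ, ∫⁻ t in Icc (0 : ℝ) 1,
      e (g t) * w (Hfun ν μ t) * ENNReal.ofReal (μ - qf ν t) ≠ ⊤ := by
    intro g
    refine ne_top_of_le_ne_top ENNReal.one_ne_top ((lintegral_mono_ae (g := fun _ ↦ 1) ?_).trans ?_)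
    · filter_upwards [hbound] with t ht
      rw [mul_assoc]
      exact mul_le_one' (he1 _) ht
    · simp
  have hident : ∀ᵐ t ∂(volume.restrict (Icc (0 : ℝ) 1)),
      ENNReal.ofReal (ufun ν μ (Hfun ν μ t)) * e (qf ν (Bfun ν μ (Hfun ν μ t))) +
        ENNReal.ofReal (1 - ufun ν μ (Hfun ν μ t)) * e (qf ν (Afun ν μ (Hfun ν μ t))) +
        (e (qf ν (Afun ν μ (Hfun ν μ t))) * w (Hfun ν μ t) * ENNReal.ofReal (μ - qf ν t) +
          e (qf ν (Bfun ν μ (Hfun ν μ t))) * w (Hfun ν μ t) * ENNReal.ofReal (qf ν t - μ)) =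
      e (qf ν t) +
        (e (qf ν (Afun ν μ (Hfun ν μ t))) * w (Hfun ν μ t) * ENNReal.ofReal (qf ν t - μ) +
          e (qf ν (Bfun ν μ (Hfun ν μ t))) * w (Hfun ν μ t) * ENNReal.ofReal (μ - qf ν t)) := by
    filter_upwards [ae_level_cases hint hμ] with t ht
    rcases ht with ⟨ha, hb, hq, hu⟩ | ⟨ha, hb, hu, hq⟩
    · rw [ha, hb, hq, hu, ← add_mul, ← ENNReal.ofReal_add (by norm_num) (by norm_num)]
      norm_num
    · rw [hu]
      exact two_point_exchange ha hb hq e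
  have hint_eq := lintegral_congr_ae hident
  have hJa := lintegral_comp_Hfun_mul hint hμ hfa
  have hJb := lintegral_comp_Hfun_mul hint hμ hfb
  have hsum : Measurable fun t ↦
      e (qf ν (Afun ν μ (Hfun ν μ t))) * w (Hfun ν μ t) * ENNReal.ofReal (μ - qf ν t) +
        e (qf ν (Bfun ν μ (Hfun ν μ t))) * w (Hfun ν μ t) * ENNReal.ofReal (qf ν t - μ) :=
    ((hfa.comp hH).mul hn).add ((hfb.comp hH).mul hp)
  have heq : Measurable fun t ↦ e (qf ν t) := he.comp (measurable_qf ν)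
  have hap : Measurable fun t ↦
      e (qf ν (Afun ν μ (Hfun ν μ t))) * w (Hfun ν μ t) * ENNReal.ofReal (qf ν t - μ) :=
    (hfa.comp hH).mul hp
  have han : Measurable fun t ↦
      e (qf ν (Afun ν μ (Hfun ν μ t))) * w (Hfun ν μ t) * ENNReal.ofReal (μ - qf ν t) :=
    (hfa.comp hH).mul hn
  rw [lintegral_add_right _ hsum, lintegral_add_left heq, lintegral_add_left han,
    lintegral_add_left hap,
    hJa, hJb] at hint_eq
  exact (ENNReal.add_left_inj (ENNReal.add_ne_top.2 ⟨hfin _, hfin _⟩)).1 hint_eq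

lemma map_rotationRV (hint : Integrable id ν) (hμ : μ = ∫ x, x ∂ν) (i : ℕ) :
    ((volume.restrict (Icc (0 : ℝ) 1)).prod (volume.restrict (Icc (0 : ℝ) 1))).map
      (rotationRV ν μ i) = ν := by
  have hX := measurable_rotationRV hint hμ i
  ext E hE
  have he : Measurable (E.indicator (1 : ℝ → ENNReal)) := measurable_one.indicator hE
  have heX : Measurable fun ω ↦ E.indicator (1 : ℝ → ENNReal) (rotationRV ν μ i ω) := he.comp hX
  rw [← lintegral_indicator_one hE, lintegral_map he hX, lintegral_prod _ heX.aemeasurable]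
  have hinner : ∀ᵐ t ∂(volume.restrict (Icc (0 : ℝ) 1)),
      ∫⁻ v in Icc (0 : ℝ) 1, E.indicator 1 (rotationRV ν μ i (t, v)) =
        ENNReal.ofReal (ufun ν μ (Hfun ν μ t)) * E.indicator 1 (qf ν (Bfun ν μ (Hfun ν μ t))) +
        ENNReal.ofReal (1 - ufun ν μ (Hfun ν μ t)) *
          E.indicator 1 (qf ν (Afun ν μ (Hfun ν μ t))) := by
    filter_upwards [ae_level_mean hint hμ] with t ht
    exact lintegral_rotation ht.1 ht.2.1 (i * ufun ν μ (Hfun ν μ t))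
      (qf ν (Afun ν μ (Hfun ν μ t))) (qf ν (Bfun ν μ (Hfun ν μ t))) (E.indicator 1)
  rw [lintegral_congr_ae hinner, lintegral_two_point hint hμ he
    (fun x ↦ indicator_le (fun _ _ ↦ le_rfl) x), ← lintegral_map he (measurable_qf ν), map_qf,
    lintegral_indicator_one hE]

end Construction

/-- **Theorem 2.1.** For any distribution `F` on `ℝ` with finite mean `μ` there exist
random variables `X₁, X₂, …` with common distribution `F`, and `Z` distributed as the
residual distribution `F̃` of `F`, on one probability space, such that for every `n`,
`|S_n − nμ| ≤ Z` almost surely, where `S_n = X₁ + ⋯ + X_n`. -/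
theorem extreme_negative_dependence_construction
    (ν : Measure ℝ) [IsProbabilityMeasure ν] (μ : ℝ)
    (hint : Integrable id ν) (hμ : μ = ∫ x, x ∂ν) :
    ∃ (Ω : Type) (mΩ : MeasurableSpace Ω) (P : Measure Ω)
      (X : ℕ → Ω → ℝ) (Z : Ω → ℝ),
      IsProbabilityMeasure P ∧
      (∀ i, Measure.map (X i) P = ν) ∧
      Measure.map Z P = residualDist ν μ ∧
      ∀ n : ℕ, ∀ᵐ ω ∂P, |(∑ i ∈ Finset.range n, X i ω) - (n : ℝ) * μ| ≤ Z ω := by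

  have hresidual : Measurable fun t ↦
      qf ν (Bfun ν μ (Hfun ν μ t)) - qf ν (Afun ν μ (Hfun ν μ t)) :=
    (((measurable_qf ν).comp (measurable_Bfun hint hμ)).sub
      ((measurable_qf ν).comp (measurable_Afun hint))).comp (continuous_Hfun hint).measurable
  refine ⟨ℝ × ℝ, inferInstance,
    (volume.restrict (Icc (0 : ℝ) 1)).prod (volume.restrict (Icc (0 : ℝ) 1)), rotationRV ν μ,
    fun ω ↦ qf ν (Bfun ν μ (Hfun ν μ ω.1)) - qf ν (Afun ν μ (Hfun ν μ ω.1)),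
    inferInstance, map_rotationRV hint hμ, ?_, fun n ↦ ?_⟩
  · rw [residualDist_eq_map hint hμ]
    conv_rhs => rw [← Measure.fst_prod (μ := volume.restrict (Icc (0 : ℝ) 1))
      (ν := volume.restrict (Icc (0 : ℝ) 1)), Measure.fst,
      Measure.map_map hresidual measurable_fst]
    rfl
  · filter_upwards [Measure.quasiMeasurePreserving_fst.ae (ae_level_mean hint hμ)] with ω hω
    exact abs_sum_rotation_sub_le hω.1 hω.2.1 hω.2.2.1 hω.2.2.2 ω.2 n
end

section
/- Let F be a cumulative distribution function on ℝ with finite mean μ. Then there exists a sequence of random variables X_i, i ∈ ℕ, each with distribution F, such that (S_n − nμ)/k_n → 0 almost surely for every sequence of real numbers k_n → ∞, where S_n = X₁ + ⋯ + X_n; that is, there exists an extremely negatively dependent (END) sequence with common distribution F. -/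
open MeasureTheory ProbabilityTheory Set Filter Topology Asymptotics

/-- The `n`-th term of the Sturmian `0`-`1` sequence with slope `p` and intercept `u`. -/
noncomputable def sturmian (p u : ℝ) (n : ℕ) : ℤ := ⌊u + (n + 1 : ℕ) * p⌋ - ⌊u + n * p⌋

lemma sum_sturmian (p u : ℝ) (n : ℕ) :
    ∑ i ∈ Finset.range n, sturmian p u i = ⌊u + n * p⌋ - ⌊u⌋ := by
  simpa [sturmian] using Finset.sum_range_sub (fun i : ℕ => ⌊u + i * p⌋) n

lemma abs_sum_sturmian_sub_le (p u : ℝ) (n : ℕ) :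
    |((∑ i ∈ Finset.range n, sturmian p u i : ℤ) : ℝ) - n * p| ≤ 1 := by
  rw [sum_sturmian, abs_le]
  push_cast
  constructor <;> linarith [Int.floor_le (u + n * p), Int.lt_floor_add_one (u + n * p),
    Int.floor_le u, Int.lt_floor_add_one u]

lemma sturmian_eq_zero_or_one {p : ℝ} (hp : p ∈ Icc (0 : ℝ) 1) (u : ℝ) (n : ℕ) :
    sturmian p u n = 0 ∨ sturmian p u n = 1 := by
  have h₀ : ⌊u + n * p⌋ ≤ ⌊u + (n + 1 : ℕ) * p⌋ :=
    Int.floor_mono (by push_cast; linarith [hp.1])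
  have h₁ : ⌊u + (n + 1 : ℕ) * p⌋ ≤ ⌊u + n * p + 1⌋ :=
    Int.floor_mono (by push_cast; linarith [hp.2])
  rw [Int.floor_add_one] at h₁
  unfold sturmian
  omega

@[fun_prop]
lemma Measurable.sturmian {α : Type*} [MeasurableSpace α] {p u : α → ℝ}
    (hp : Measurable p) (hu : Measurable u) (n : ℕ) :
    Measurable fun x => sturmian (p x) (u x) n := by
  unfold _root_.sturmian
  fun_prop

lemma intervalIntegrable_fract_add (x : ℝ) :
    IntervalIntegrable (fun u : ℝ => Int.fract (u + x)) volume 0 1 := by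
  refine (intervalIntegrable_const (c := (1 : ℝ))).mono_fun
    (measurable_fract.comp (measurable_add_const x)).aestronglyMeasurable
    (.of_forall fun u => ?_)
  beta_reduce
  rw [Real.norm_of_nonneg (Int.fract_nonneg _)]
  simpa using (Int.fract_lt_one _).le

lemma intervalIntegrable_floor_add (x : ℝ) :
    IntervalIntegrable (fun u : ℝ => (⌊u + x⌋ : ℝ)) volume 0 1 := by
  have h : IntervalIntegrable (fun u : ℝ => u + x) volume 0 1 :=
    Continuous.intervalIntegrable (by fun_prop) _ _
  refine (h.sub (intervalIntegrable_fract_add x)).congr ?_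
  exact fun u _ => Int.self_sub_fract _

lemma integral_floor_add (x : ℝ) :
    ∫ u in (0 : ℝ)..1, (⌊u + x⌋ : ℝ) = x := by
  have hper : Function.Periodic (Int.fract : ℝ → ℝ) 1 := fun y => Int.fract_add_one y
  have hfract : ∫ u in (0 : ℝ)..1, Int.fract (u + x) = 1 / 2 := by
    rw [intervalIntegral.integral_comp_add_right, zero_add, add_comm 1 x,
      hper.intervalIntegral_add_eq x 0, zero_add]
    have : ∫ u in (0 : ℝ)..1, Int.fract u = ∫ u in (0 : ℝ)..1, u := by
      refine intervalIntegral.integral_congr_Ioo_of_le zero_le_one fun u hu => ?_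
      exact Int.fract_eq_self.2 ⟨hu.1.le, hu.2⟩
    rw [this]
    norm_num
  have h : IntervalIntegrable (fun u : ℝ => u + x) volume 0 1 :=
    Continuous.intervalIntegrable (by fun_prop) _ _
  simp_rw [← Int.self_sub_fract]
  rw [intervalIntegral.integral_sub h (intervalIntegrable_fract_add x), hfract,
    intervalIntegral.integral_add (by simp) (by simp)]
  norm_num

lemma integral_sturmian (p : ℝ) (n : ℕ) :
    ∫ u in Ioc (0 : ℝ) 1, (sturmian p u n : ℝ) = p := by
  rw [← intervalIntegral.integral_of_le zero_le_one]
  simp only [sturmian, Int.cast_sub]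
  rw [intervalIntegral.integral_sub (intervalIntegrable_floor_add _)
    (intervalIntegrable_floor_add _), integral_floor_add, integral_floor_add]
  push_cast
  ring

lemma integrable_sturmian (p : ℝ) (n : ℕ) :
    IntegrableOn (fun u => (sturmian p u n : ℝ)) (Ioc 0 1) := by
  rw [← intervalIntegrable_iff_integrableOn_Ioc_of_le zero_le_one]
  simpa [sturmian] using (intervalIntegrable_floor_add ((n + 1 : ℕ) * p)).sub
    (intervalIntegrable_floor_add (n * p))

lemma lintegral_sturmian {p : ℝ} (hp : p ∈ Icc (0 : ℝ) 1) (n : ℕ) :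
    ∫⁻ u in Ioc (0 : ℝ) 1, ENNReal.ofReal (sturmian p u n) = ENNReal.ofReal p := by
  rw [← ofReal_integral_eq_lintegral_ofReal (integrable_sturmian p n), integral_sturmian]
  refine .of_forall fun u => ?_
  rcases sturmian_eq_zero_or_one hp u n with h | h <;> simp [h]

lemma lintegral_one_sub_sturmian {p : ℝ} (hp : p ∈ Icc (0 : ℝ) 1) (n : ℕ) :
    ∫⁻ u in Ioc (0 : ℝ) 1, ENNReal.ofReal (1 - sturmian p u n) = ENNReal.ofReal (1 - p) := by
  have hc : IntegrableOn (fun _ => (1 : ℝ)) (Ioc (0 : ℝ) 1) := by simp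
  have hsub : IntegrableOn (fun u => 1 - (sturmian p u n : ℝ)) (Ioc 0 1) :=
    hc.sub (integrable_sturmian p n)
  rw [← ofReal_integral_eq_lintegral_ofReal hsub,
    integral_sub hc (integrable_sturmian p n), integral_sturmian]
  · simp
  · refine .of_forall fun u => ?_
    rcases sturmian_eq_zero_or_one hp u n with h | h <;> simp [h]

/-- The probability of the larger value `b` in the law on `{a, b}` with mean `μ`. -/
noncomputable def upperWeight (μ a b : ℝ) : ℝ := (μ - a) / (b - a)

@[fun_prop]
lemma Measurable.upperWeight {α : Type*} [MeasurableSpace α] (μ : ℝ) {a b : α → ℝ}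
    (ha : Measurable a) (hb : Measurable b) :
    Measurable fun x => upperWeight μ (a x) (b x) := by
  unfold _root_.upperWeight
  fun_prop

lemma upperWeight_mem_Icc {μ a b : ℝ} (ha : a ≤ μ) (hb : μ < b) :
    upperWeight μ a b ∈ Icc (0 : ℝ) 1 :=
  ⟨div_nonneg (by linarith) (by linarith), div_le_one_of_le₀ (by linarith) (by linarith)⟩

/-- The `n`-th term of a balanced sequence with values in `{a, b}` and average `μ`. -/
noncomputable def balanced (μ : ℝ) (n : ℕ) (z : (ℝ × ℝ) × ℝ) : ℝ :=
  z.1.1 + (z.1.2 - z.1.1) * sturmian (upperWeight μ z.1.1 z.1.2) z.2 n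

lemma measurable_balanced (μ : ℝ) (n : ℕ) : Measurable (balanced μ n) := by
  unfold balanced
  fun_prop

lemma abs_sum_balanced_sub_le {μ : ℝ} {z : (ℝ × ℝ) × ℝ} (hz : z.1.1 < z.1.2) (n : ℕ) :
    |∑ i ∈ Finset.range n, balanced μ i z - n * μ| ≤ z.1.2 - z.1.1 := by
  obtain ⟨⟨a, b⟩, u⟩ := z
  replace hz : a < b := hz
  have hba : b - a ≠ 0 := by linarith
  have key : ∑ i ∈ Finset.range n, balanced μ i ((a, b), u) - n * μ = (b - a) *
      (((∑ i ∈ Finset.range n, sturmian (upperWeight μ a b) u i : ℤ) : ℝ)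
        - n * upperWeight μ a b) := by
    have hμ : (b - a) * upperWeight μ a b = μ - a := mul_div_cancel₀ _ hba
    simp only [balanced, Finset.sum_add_distrib, ← Finset.mul_sum]
    push_cast
    simp only [Finset.sum_const, Finset.card_range, nsmul_eq_mul]
    linear_combination (n : ℝ) * hμ
  rw [key, abs_mul, abs_of_pos (by linarith : 0 < b - a)]
  exact mul_le_of_le_one_right (by linarith) (abs_sum_sturmian_sub_le _ _ _)

lemma lintegral_comp_balanced {μ a b : ℝ} (ha : a ≤ μ) (hb : μ < b) (n : ℕ)
    (g : ℝ → ENNReal) :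
    ∫⁻ u in Ioc (0 : ℝ) 1, g (balanced μ n ((a, b), u)) =
      g b * ENNReal.ofReal (upperWeight μ a b)
        + g a * ENNReal.ofReal (1 - upperWeight μ a b) := by
  have hp := upperWeight_mem_Icc ha hb
  rw [← lintegral_sturmian hp n, ← lintegral_one_sub_sturmian hp n,
    ← lintegral_const_mul _ (by fun_prop), ← lintegral_const_mul _ (by fun_prop),
    ← lintegral_add_left (by fun_prop)]
  congr with u
  rcases sturmian_eq_zero_or_one hp u n with h | h <;> simp [balanced, h]

/-- The law of the pair of values `(a, b)`, with `a ≤ μ < b`, whose two-point laws with mean `μ`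
mix to `ν`. -/
noncomputable def pairLaw (ν : Measure ℝ) (μ : ℝ) : Measure (ℝ × ℝ) :=
  ((ν.restrict (Iic μ)).prod (ν.restrict (Ioi μ))).withDensity fun z =>
    ENNReal.ofReal (z.2 - z.1) / ∫⁻ x, ENNReal.ofReal (x - μ) ∂ν

lemma ae_pairLaw {ν : Measure ℝ} [SFinite ν] {μ : ℝ} :
    ∀ᵐ z ∂pairLaw ν μ, z.1 ≤ μ ∧ μ < z.2 := by
  refine (withDensity_absolutelyContinuous _ _).ae_le ?_
  rw [Measure.prod_restrict]
  exact ae_restrict_mem (measurableSet_Iic.prod measurableSet_Ioi)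

lemma lintegral_ofReal_sub_eq {ν : Measure ℝ} [IsProbabilityMeasure ν] {μ : ℝ}
    (hint : Integrable id ν) (hμ : μ = ∫ x, x ∂ν) :
    ∫⁻ x, ENNReal.ofReal (x - μ) ∂ν = ∫⁻ x, ENNReal.ofReal (μ - x) ∂ν ∧
      ∫⁻ x, ENNReal.ofReal (x - μ) ∂ν ≠ ⊤ := by
  have h₁ : Integrable (fun x => x - μ) ν := hint.sub (integrable_const μ)
  have h₂ : Integrable (fun x => μ - x) ν := (integrable_const μ).sub hint
  have h₀ : ∫ x, (x - μ) ∂ν = 0 := by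
    rw [integral_sub (f := fun x => x) hint (integrable_const μ)]
    simp [← hμ]
  refine ⟨?_, h₁.lintegral_lt_top.ne⟩
  rw [integral_eq_lintegral_pos_part_sub_lintegral_neg_part h₁, sub_eq_zero,
    ENNReal.toReal_eq_toReal_iff' h₁.lintegral_lt_top.ne (by
      simpa only [neg_sub] using h₂.lintegral_lt_top.ne)] at h₀
  simpa only [neg_sub] using h₀

lemma lintegral_balanced {ν : Measure ℝ} [IsProbabilityMeasure ν] {μ : ℝ}
    (hint : Integrable id ν) (hμ : μ = ∫ x, x ∂ν)
    (h₀ : ∫⁻ x, ENNReal.ofReal (x - μ) ∂ν ≠ 0) (n : ℕ) {g : ℝ → ENNReal} (hg : Measurable g) :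
    ∫⁻ z, g (balanced μ n z) ∂(pairLaw ν μ).prod (volume.restrict (Ioc 0 1)) =
      ∫⁻ x, g x ∂ν := by
  obtain ⟨hsymm, htop⟩ := lintegral_ofReal_sub_eq hint hμ
  have hup : ∫⁻ x in Ioi μ, ENNReal.ofReal (x - μ) ∂ν = ∫⁻ x, ENNReal.ofReal (x - μ) ∂ν := by
    refine setLIntegral_eq_of_support_subset fun x hx => ?_
    simpa using hx
  have hlow : ∫⁻ x in Iic μ, ENNReal.ofReal (μ - x) ∂ν = ∫⁻ x, ENNReal.ofReal (x - μ) ∂ν := by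
    rw [hsymm]
    refine setLIntegral_eq_of_support_subset fun x hx => ?_
    simpa using (show x < μ by simpa using hx).le
  set M := ∫⁻ x, ENNReal.ofReal (x - μ) ∂ν
  have hmeas : Measurable fun z => g (balanced μ n z) := hg.comp (measurable_balanced μ n)
  rw [lintegral_prod _ hmeas.aemeasurable]
  have hinner : ∀ᵐ z ∂pairLaw ν μ, ∫⁻ u in Ioc (0 : ℝ) 1, g (balanced μ n (z, u)) =
      g z.2 * ENNReal.ofReal (upperWeight μ z.1 z.2)
        + g z.1 * ENNReal.ofReal (1 - upperWeight μ z.1 z.2) := by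
    filter_upwards [ae_pairLaw] with z hz
    exact lintegral_comp_balanced hz.1 hz.2 n g
  rw [lintegral_congr_ae hinner, pairLaw,
    lintegral_withDensity_eq_lintegral_mul _ (by fun_prop) (by fun_prop)]
  have hweights : ∀ᵐ z ∂(ν.restrict (Iic μ)).prod (ν.restrict (Ioi μ)),
      ((fun z : ℝ × ℝ => ENNReal.ofReal (z.2 - z.1) / M) * fun z : ℝ × ℝ =>
        g z.2 * ENNReal.ofReal (upperWeight μ z.1 z.2)
          + g z.1 * ENNReal.ofReal (1 - upperWeight μ z.1 z.2)) z =
      M⁻¹ * (ENNReal.ofReal (μ - z.1) * g z.2 + g z.1 * ENNReal.ofReal (z.2 - μ)) := by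
    rw [Measure.prod_restrict]
    filter_upwards [ae_restrict_mem (measurableSet_Iic.prod measurableSet_Ioi)] with ⟨a, b⟩ hz
    obtain ⟨ha, hb⟩ : a ≤ μ ∧ μ < b := hz
    have hab : 0 < b - a := by linarith
    have hw : (b - a) * upperWeight μ a b = μ - a := mul_div_cancel₀ _ hab.ne'
    have e₁ : ENNReal.ofReal (μ - a) =
        ENNReal.ofReal (b - a) * ENNReal.ofReal (upperWeight μ a b) := by
      rw [← ENNReal.ofReal_mul hab.le, hw]
    have e₂ : ENNReal.ofReal (b - μ) =
        ENNReal.ofReal (b - a) * ENNReal.ofReal (1 - upperWeight μ a b) := by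
      rw [← ENNReal.ofReal_mul hab.le]
      congr 1
      linear_combination hw
    simp only [Pi.mul_apply, e₁, e₂, div_eq_mul_inv]
    ring
  rw [lintegral_congr_ae hweights, lintegral_const_mul _ (by fun_prop),
    lintegral_add_left (by fun_prop),
    lintegral_prod_mul (f := fun a => ENNReal.ofReal (μ - a)) (g := g) (by fun_prop) (by fun_prop),
    lintegral_prod_mul (f := g) (g := fun b => ENNReal.ofReal (b - μ)) (by fun_prop) (by fun_prop),
    hup, hlow, mul_comm _ M, ← mul_add, ← mul_assoc, ENNReal.inv_mul_cancel h₀ htop, one_mul,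
    add_comm, ← compl_Iic, lintegral_add_compl g measurableSet_Iic]

lemma tendsto_div_of_abs_le {s k : ℕ → ℝ} {C : ℝ} (hs : ∀ n, |s n| ≤ C)
    (hk : Tendsto k atTop atTop) : Tendsto (fun n => s n / k n) atTop (𝓝 0) := by
  simp only [div_eq_mul_inv]
  exact bdd_le_mul_tendsto_zero' C (.of_forall hs) hk.inv_tendsto_atTop

/-- **Corollary 2.1 (b).** For any distribution `F` with finite mean `μ` there exists an
extremely negatively dependent (END) sequence with common distribution `F`: random
variables `X₁, X₂, …`, each distributed as `F`, such that `(S_n − nμ)/k_n → 0` almost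
surely for every sequence `k_n → ∞`. -/
theorem exists_END_sequence
    (ν : Measure ℝ) [IsProbabilityMeasure ν] (μ : ℝ)
    (hint : Integrable id ν) (hμ : μ = ∫ x, x ∂ν) :
    ∃ (Ω : Type) (mΩ : MeasurableSpace Ω) (P : Measure Ω) (X : ℕ → Ω → ℝ),
      IsProbabilityMeasure P ∧
      (∀ i, Measure.map (X i) P = ν) ∧
      ∀ k : ℕ → ℝ, Tendsto k atTop atTop →
        ∀ᵐ ω ∂P,
          Tendsto (fun n : ℕ => ((∑ i ∈ Finset.range n, X i ω) - (n : ℝ) * μ) / k n)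
            atTop (nhds 0) := by
  obtain ⟨hsymm, -⟩ := lintegral_ofReal_sub_eq hint hμ
  by_cases h₀ : ∫⁻ x, ENNReal.ofReal (x - μ) ∂ν = 0
  · refine ⟨ℝ, inferInstance, ν, fun _ => id, inferInstance, fun _ => Measure.map_id,
      fun k _ => ?_⟩
    have h₁ := hsymm.symm.trans h₀
    rw [lintegral_eq_zero_iff (by fun_prop)] at h₀ h₁
    filter_upwards [h₀, h₁] with x hx hx'
    have hx₀ : x = μ := le_antisymm (by simpa using hx) (by simpa using hx')
    simp [hx₀]
  · set P := (pairLaw ν μ).prod (volume.restrict (Ioc (0 : ℝ) 1))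
    have hmap : ∀ i, P.map (balanced μ i) = ν := fun i => Measure.ext_of_lintegral _ fun g hg => by
      rw [lintegral_map hg (measurable_balanced μ i), lintegral_balanced hint hμ h₀ i hg]
    have hP : IsProbabilityMeasure P := by
      constructor
      rw [← preimage_univ (f := balanced μ 0), ← Measure.map_apply (measurable_balanced μ 0) .univ,
        hmap 0, measure_univ]
    refine ⟨_, inferInstance, P, balanced μ, hP, hmap, fun k hk => ?_⟩
    filter_upwards [Measure.quasiMeasurePreserving_fst.ae (ae_pairLaw (ν := ν) (μ := μ))] with z hz
    exact tendsto_div_of_abs_le (abs_sum_balanced_sub_le (hz.1.trans_lt hz.2)) hk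
end
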